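/- With p_i = 1/(d+1) and ρ_d as above, for 1 ≤ i < j ≤ d: ∫_{Δ_d} [ (1/(x_i x_j)) / (Σ_{k=1}^{d+1} 1/x_k)^2 ] ρ_d(x) dx = 1/((d+1)(d+3)). -/

import Mathlib

open MeasureTheory Set

/-- The standard `d`-simplex in `ℝ^d`. -/
def simplexDelta (d : ℕ) : Set (Fin d → ℝ) :=
  {x | (∀ i, 0 ≤ x i) ∧ ∑ i, x i ≤ 1}

/-- Extend `x ∈ Δ_d` by the last barycentric coordinate `x_{d+1} = 1 - Σ x_i`. -/
noncomputable def extCoord {d : ℕ} (x : Fin d → ℝ) : Fin (d + 1) → ℝ :=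
  Fin.snoc x (1 - ∑ i, x i)

/-- The density on `Δ_d` of the projection of the `Dirichlet(1/2, θ, ν₀)` process,
with weights `p : Fin (d+1) → ℝ`. -/
noncomputable def rhoD (d : ℕ) (θ : ℝ) (p : Fin (d + 1) → ℝ) (x : Fin d → ℝ) : ℝ :=
  ((∏ j, p j) * Real.Gamma (θ + ((d : ℝ) + 1) / 2) /
      (Real.pi ^ ((d : ℝ) / 2) * Real.Gamma (θ + 1 / 2))) *
    (∏ j, extCoord x j ^ (-(3 : ℝ) / 2)) /
    (∑ j, (p j) ^ 2 / extCoord x j) ^ (θ + ((d : ℝ) + 1) / 2)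


open scoped ENNReal

/-- Inverse-gamma type kernel. -/
noncomputable def igk (a s : ℝ) : ℝ≥0∞ :=
  (Ioi (0:ℝ)).indicator (fun s => ENNReal.ofReal (s ^ (-a) * Real.exp (-s⁻¹))) s

lemma measurable_igk (a : ℝ) : Measurable (igk a) := by
  unfold igk
  apply Measurable.indicator _ measurableSet_Ioi
  fun_prop

lemma invGamma_lint {b A : ℝ} (hb : 0 < b) (hA : 0 < A) :
    ∫⁻ r in Ioi (0:ℝ), ENNReal.ofReal (r ^ (-b - 1) * Real.exp (-(A * r⁻¹)))
      = ENNReal.ofReal (Real.Gamma b * A ^ (-b)) := by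
  have hint : IntegrableOn (fun y : ℝ => y ^ (b - 1) * Real.exp (-(A * y))) (Ioi 0) := by
    have := integrableOn_rpow_mul_exp_neg_mul_rpow (p := 1) (s := b - 1) (b := A)
      (by linarith) one_pos hA
    simpa using this
  have hval := Real.integral_rpow_mul_exp_neg_mul_Ioi hb hA
  have key : ∀ x ∈ Ioi (0:ℝ), (|(-1:ℝ)| * x ^ ((-1:ℝ) - 1)) •
      ((x ^ (-1:ℝ)) ^ (b - 1) * Real.exp (-(A * x ^ (-1:ℝ))))
      = x ^ (-b - 1) * Real.exp (-(A * x⁻¹)) := by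
    intro x hx
    have hx : 0 < x := hx
    rw [← Real.rpow_mul hx.le, Real.rpow_neg_one, smul_eq_mul, ← mul_assoc]
    congr 1
    rw [abs_neg, abs_one, one_mul, ← Real.rpow_add hx]
    congr 1; ring
  have h1 := integral_comp_rpow_Ioi (fun y : ℝ => y ^ (b - 1) * Real.exp (-(A * y)))
    (p := -1) (by norm_num)
  have h2 := (integrableOn_Ioi_comp_rpow_iff (fun y : ℝ => y ^ (b - 1) * Real.exp (-(A * y)))
    (p := -1) (by norm_num)).2 hint
  rw [setIntegral_congr_fun measurableSet_Ioi key, hval] at h1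
  have h3 := h2.congr_fun key measurableSet_Ioi
  rw [← ofReal_integral_eq_lintegral_ofReal h3, h1]
  · congr 1
    rw [one_div, Real.inv_rpow hA.le, Real.rpow_neg hA.le, mul_comm]
  · filter_upwards [ae_restrict_mem measurableSet_Ioi] with x hx
    have hx : 0 < x := hx
    simp only [Pi.zero_apply]
    positivity

lemma lint_igk {a : ℝ} (ha : 1 < a) : ∫⁻ s, igk a s = ENNReal.ofReal (Real.Gamma (a - 1)) := by
  unfold igk
  rw [lintegral_indicator measurableSet_Ioi]
  have := invGamma_lint (b := a - 1) (A := 1) (by linarith) one_pos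
  simp only [Real.one_rpow, mul_one, one_mul] at this
  rw [← this]
  congr 1; ext s; congr 3; ring

lemma lint_prod {n : ℕ} (f : Fin n → ℝ → ℝ≥0∞) (hf : ∀ i, Measurable (f i)) :
    ∫⁻ x : Fin n → ℝ, ∏ i, f i (x i) = ∏ i, ∫⁻ s, f i s := by
  induction n with
  | zero => simp [volume_pi]
  | succ n ih =>
    have h := (volume_preserving_piFinSuccAbove (fun _ : Fin (n+1) => ℝ) 0).symm
    rw [← h.lintegral_comp_emb (MeasurableEquiv.measurableEmbedding _)]
    rw [Fin.prod_univ_succ, ← ih (fun i => f i.succ) (fun i => hf _),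
      ← lintegral_prod_mul (hf 0).aemeasurable]
    · rw [Measure.volume_eq_prod]
      congr 1; ext z
      simp [MeasurableEquiv.piFinSuccAbove_symm_apply, Fin.insertNthEquiv, Fin.prod_univ_succ]
    · apply Measurable.aemeasurable
      apply Finset.measurable_fun_prod
      intro i _
      exact (hf _).comp (measurable_pi_apply i)

lemma lint_smul {d : ℕ} (f : (Fin d → ℝ) → ℝ≥0∞) {r : ℝ} (hr : 0 < r) :
    ENNReal.ofReal (r ^ d) * ∫⁻ x, f (r • x) = ∫⁻ x, f x := by
  have h := Measure.map_addHaar_smul (volume : Measure (Fin d → ℝ)) hr.ne'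
  have h2 : ∫⁻ x, f (r • x) = ∫⁻ x, f x ∂(Measure.map (r • ·) (volume : Measure (Fin d → ℝ))) :=
    ((Homeomorph.smulOfNeZero r hr.ne').measurableEmbedding.lintegral_map f).symm
  rw [h2, h, lintegral_smul_measure, smul_eq_mul, ← mul_assoc, ← ENNReal.ofReal_mul (by positivity)]
  have : 0 < r ^ d := by positivity
  rw [Module.finrank_fin_fun, abs_of_pos (by positivity), mul_inv_cancel₀ this.ne']
  simp

lemma prod_snoc {d : ℕ} (a : Fin (d+1) → ℝ) (y : Fin d → ℝ) (s : ℝ) :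
    ∏ k, igk (a k) ((Fin.snoc y s : Fin (d+1) → ℝ) k) =
      (∏ k : Fin d, igk (a k.castSucc) (y k)) * igk (a (Fin.last d)) s := by
  rw [Fin.prod_univ_castSucc]; simp

lemma igk_of_nonpos {a s : ℝ} (h : s ≤ 0) : igk a s = 0 := by
  simp [igk, h]

lemma ext_smul {d : ℕ} (r : ℝ) (x : Fin d → ℝ) (k : Fin (d+1)) :
    r * extCoord x k = (Fin.snoc (r • x) (r - ∑ i, (r • x) i) : Fin (d+1) → ℝ) k := by
  unfold extCoord
  refine Fin.lastCases ?_ (fun k => ?_) k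
  · simp [mul_sub, Finset.mul_sum]
  · simp

lemma cone_lint {d : ℕ} (a : Fin (d+1) → ℝ) (ha : ∀ k, 1 < a k) :
    ∫⁻ x : Fin d → ℝ, ∫⁻ r in Ioi (0:ℝ), ENNReal.ofReal (r ^ d) * ∏ k, igk (a k) (r * extCoord x k)
      = ∏ k, ENNReal.ofReal (Real.Gamma (a k - 1)) := by
  have hm : ∀ (g : (Fin d → ℝ) × ℝ → Fin (d+1) → ℝ), Measurable g →
      Measurable (fun z => ∏ k, igk (a k) (g z k)) := by
    intro g hg
    apply Finset.measurable_fun_prod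
    intro i _
    exact (measurable_igk _).comp ((measurable_pi_apply i).comp hg)
  have hsn : ∀ (u : (Fin d → ℝ) × ℝ → Fin d → ℝ) (v : (Fin d → ℝ) × ℝ → ℝ), Measurable u →
      Measurable v → Measurable (fun z => (Fin.snoc (u z) (v z) : Fin (d+1) → ℝ)) := by
    intro u v hu hv
    rw [measurable_pi_iff]
    intro k
    refine Fin.lastCases ?_ (fun k => ?_) k
    · simpa using hv
    · simpa [Function.comp_def] using (measurable_pi_apply k).comp hu
  simp only [ext_smul]
  rw [lintegral_lintegral_swap]
  swap
  · apply Measurable.aemeasurable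
    apply Measurable.mul
    · fun_prop
    · apply hm
      apply hsn <;> fun_prop
  have h1 : ∀ r ∈ Ioi (0:ℝ), ∫⁻ x : Fin d → ℝ, ENNReal.ofReal (r ^ d) *
      ∏ k, igk (a k) ((Fin.snoc (r • x) (r - ∑ i, (r • x) i) : Fin (d+1) → ℝ) k)
      = ∫⁻ y : Fin d → ℝ, ∏ k, igk (a k) ((Fin.snoc y (r - ∑ i, y i) : Fin (d+1) → ℝ) k) := by
    intro r hr
    rw [lintegral_const_mul' _ _ ENNReal.ofReal_ne_top]
    exact lint_smul (fun y => ∏ k, igk (a k) ((Fin.snoc y (r - ∑ i, y i) : Fin (d+1) → ℝ) k)) hr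
  rw [setLIntegral_congr_fun measurableSet_Ioi h1, lintegral_lintegral_swap]
  swap
  · apply Measurable.aemeasurable
    exact (hm _ (hsn Prod.fst (fun z => z.2 - ∑ i, z.1 i) (by fun_prop) (by fun_prop))).comp
      measurable_swap
  have h2 : ∀ y : Fin d → ℝ, ∫⁻ r in Ioi (0:ℝ),
      ∏ k, igk (a k) ((Fin.snoc y (r - ∑ i, y i) : Fin (d+1) → ℝ) k)
      = (∏ k : Fin d, igk (a k.castSucc) (y k)) *
          ENNReal.ofReal (Real.Gamma (a (Fin.last d) - 1)) := by
    intro y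
    simp only [prod_snoc]
    by_cases hy : ∀ k, 0 < y k
    · rw [← lintegral_indicator measurableSet_Ioi]
      have hS : 0 ≤ ∑ i, y i := Finset.sum_nonneg fun i _ => (hy i).le
      have : (Ioi (0:ℝ)).indicator (fun r => (∏ k : Fin d, igk (a k.castSucc) (y k)) *
          igk (a (Fin.last d)) (r - ∑ i, y i)) = fun r => (∏ k : Fin d, igk (a k.castSucc) (y k)) *
          igk (a (Fin.last d)) (r - ∑ i, y i) := by
        ext r
        by_cases hr : 0 < r
        · simp [hr]
        · rw [igk_of_nonpos (by linarith : r - ∑ i, y i ≤ 0), indicator_of_notMem (by simpa using hr), mul_zero]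
      rw [this, lintegral_const_mul]
      · rw [lintegral_sub_right_eq_self (fun s => igk (a (Fin.last d)) s), lint_igk (ha _)]
      · exact (measurable_igk _).comp (by fun_prop)
    · push Not at hy
      obtain ⟨k, hk⟩ := hy
      have : ∏ k : Fin d, igk (a k.castSucc) (y k) = 0 :=
        Finset.prod_eq_zero (Finset.mem_univ k) (igk_of_nonpos hk)
      simp [this]
  simp only [h2]
  rw [lintegral_mul_const' _ _ ENNReal.ofReal_ne_top,
    lint_prod (fun k => igk (a k.castSucc)) (fun k => measurable_igk _), Fin.prod_univ_castSucc]
  simp only [lint_igk (ha _)]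

lemma inner_lint {d : ℕ} (a : Fin (d+1) → ℝ) (ha : ∀ k, 1 < a k) (e : Fin (d+1) → ℝ)
    (he : ∀ k, 0 < e k) :
    ∫⁻ r in Ioi (0:ℝ), ENNReal.ofReal (r ^ d) * ∏ k, igk (a k) (r * e k)
     = ENNReal.ofReal ((∏ k, e k ^ (-a k)) * (Real.Gamma (∑ k, (a k - 1)) *
        (∑ k, 1 / e k) ^ (-∑ k, (a k - 1)))) := by
  have hb : 0 < ∑ k, (a k - 1) :=
    Finset.sum_pos (fun k _ => by linarith [ha k]) Finset.univ_nonempty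
  have hA : 0 < ∑ k, 1 / e k :=
    Finset.sum_pos (fun k _ => by have := he k; positivity) Finset.univ_nonempty
  have hP : 0 ≤ ∏ k, e k ^ (-a k) := Finset.prod_nonneg fun k _ => by have := he k; positivity
  rw [ENNReal.ofReal_mul hP, ← invGamma_lint hb hA, ← lintegral_const_mul' _ _ ENNReal.ofReal_ne_top]
  apply setLIntegral_congr_fun measurableSet_Ioi
  intro r hr
  have hr : 0 < r := hr
  have h0 : ∀ k, igk (a k) (r * e k) =
      ENNReal.ofReal ((r * e k) ^ (-a k) * Real.exp (-(r * e k)⁻¹)) := by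
    intro k
    have := mul_pos hr (he k)
    simp only [igk]
    rw [indicator_of_mem (by exact this)]
  simp only [h0]
  rw [← ENNReal.ofReal_prod_of_nonneg (fun k _ => by have := he k; positivity),
    ← ENNReal.ofReal_mul (by positivity), ← ENNReal.ofReal_mul hP]
  congr 1
  rw [Finset.prod_mul_distrib, ← Real.exp_sum]
  have e1 : ∑ k, -(r * e k)⁻¹ = -((∑ k, 1 / e k) * r⁻¹) := by
    rw [Finset.sum_neg_distrib, Finset.sum_mul]
    congr 1; apply Finset.sum_congr rfl; intro k _; rw [mul_inv]; ring
  have e2 : ∏ k, (r * e k) ^ (-a k) = r ^ (∑ k, -a k) * ∏ k, e k ^ (-a k) := by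
    rw [Real.rpow_sum_of_pos hr, ← Finset.prod_mul_distrib]
    apply Finset.prod_congr rfl; intro k _; rw [Real.mul_rpow hr.le (he k).le]
  have e3 : r ^ (-(∑ k, (a k - 1)) - 1) = r ^ d * r ^ (∑ k, -a k) := by
    rw [← Real.rpow_natCast r d, ← Real.rpow_add hr]
    congr 1
    simp [Finset.sum_sub_distrib]
    ring
  rw [e1, e2, e3]
  ring

lemma extCoord_castSucc {d : ℕ} (x : Fin d → ℝ) (k : Fin d) : extCoord x k.castSucc = x k := by
  simp [extCoord]

lemma extCoord_last {d : ℕ} (x : Fin d → ℝ) : extCoord x (Fin.last d) = 1 - ∑ i, x i := by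
  simp [extCoord]

lemma mem_simplex_iff {d : ℕ} (x : Fin d → ℝ) : x ∈ simplexDelta d ↔ ∀ k, 0 ≤ extCoord x k := by
  rw [Fin.forall_fin_succ']
  simp [simplexDelta, extCoord_castSucc, extCoord_last]

lemma measurable_extCoord {d : ℕ} (k : Fin (d+1)) :
    Measurable (fun x : Fin d → ℝ => extCoord x k) := by
  refine Fin.lastCases ?_ (fun k => ?_) k
  · simp only [extCoord_last]; fun_prop
  · simp only [extCoord_castSucc]; fun_prop

/-- The exponents. -/
noncomputable def expo {d : ℕ} (i j : Fin d) (k : Fin (d+1)) : ℝ :=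
  3 / 2 + (if k = i.castSucc then 1 else 0) + (if k = j.castSucc then 1 else 0)

lemma expo_gt {d : ℕ} (i j : Fin d) (k : Fin (d+1)) : 1 < expo i j k := by
  unfold expo; split_ifs <;> norm_num

lemma expo_sum {d : ℕ} (i j : Fin d) : ∑ k, (expo i j k - 1) = ((d:ℝ) + 1) / 2 + 2 := by
  simp [expo, Finset.sum_add_distrib]; ring

lemma expo_prod {d : ℕ} (i j : Fin d) (e : Fin (d+1) → ℝ) (he : ∀ k, 0 < e k) :
    ∏ k, e k ^ (-expo i j k) =
      (∏ k, e k ^ (-(3:ℝ)/2)) * (e i.castSucc)⁻¹ * (e j.castSucc)⁻¹ := by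
  have : ∀ k, e k ^ (-expo i j k) = e k ^ (-(3:ℝ)/2) *
     (if k = i.castSucc then (e k)⁻¹ else 1) * (if k = j.castSucc then (e k)⁻¹ else 1) := by
    intro k
    have h : -expo i j k = -(3:ℝ)/2 + (if k = i.castSucc then -1 else 0)
        + (if k = j.castSucc then -1 else 0) := by
      unfold expo; split_ifs <;> norm_num
    rw [h, Real.rpow_add (he k), Real.rpow_add (he k)]
    split_ifs <;> simp [Real.rpow_neg_one]
  simp only [this, Finset.prod_mul_distrib, Finset.prod_ite_eq', Finset.mem_univ, if_true]

lemma expo_gamma {d : ℕ} (i j : Fin d) (hij : i < j) :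
    ∏ k, Real.Gamma (expo i j k - 1) = √Real.pi ^ (d+1) / 4 := by
  have hne : i.castSucc ≠ j.castSucc := by
    intro h; exact hij.ne (Fin.castSucc_injective d h)
  have : ∀ k, Real.Gamma (expo i j k - 1) = √Real.pi *
     (if k = i.castSucc then (1/2) else 1) * (if k = j.castSucc then (1/2) else 1) := by
    intro k
    have h32 : Real.Gamma (3/2) = √Real.pi * (1/2) := by
      rw [show (3/2:ℝ) = 1/2 + 1 by norm_num, Real.Gamma_add_one (by norm_num),
        Real.Gamma_one_half_eq]; ring
    unfold expo
    split_ifs with h1 h2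
    · exact absurd (h1.symm.trans h2) hne
    · norm_num [h32]
    · norm_num [h32]
    · rw [show (3/2 + 0 + 0 - 1 : ℝ) = 1/2 by norm_num, Real.Gamma_one_half_eq]; ring
  simp only [this, Finset.prod_mul_distrib, Finset.prod_ite_eq', Finset.mem_univ, if_true]
  simp
  ring

/-- The normalising constant. -/
noncomputable def KK (d : ℕ) : ℝ :=
  Real.Gamma (((d:ℝ)+1)/2) / (√Real.pi ^ (d+1) * Real.Gamma (((d:ℝ)+1)/2 + 2))

lemma KK_nonneg (d : ℕ) : 0 ≤ KK d := by
  have h1 := Real.Gamma_pos_of_pos (show 0 < ((d:ℝ)+1)/2 by positivity)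
  have h2 := Real.Gamma_pos_of_pos (show 0 < ((d:ℝ)+1)/2 + 2 by positivity)
  unfold KK; positivity

lemma sqrt_pi_pow (d : ℕ) : Real.pi ^ ((d:ℝ)/2) * √Real.pi = √Real.pi ^ (d+1) := by
  rw [pow_succ, Real.sqrt_eq_rpow, ← Real.rpow_natCast (Real.pi ^ (1/2:ℝ)) d,
    ← Real.rpow_mul Real.pi_pos.le]
  congr 2; ring

lemma integrand_pos {d : ℕ} (i j : Fin d) (x : Fin d → ℝ) (he : ∀ k, 0 < extCoord x k) :
    (1 / (x i * x j)) / (∑ k, 1 / extCoord x k) ^ 2 * rhoD d 0 (fun _ => 1 / ((d : ℝ) + 1)) x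
    = KK d * ((∏ k, extCoord x k ^ (-expo i j k)) *
      (Real.Gamma (∑ k, (expo i j k - 1)) *
        (∑ k, 1 / extCoord x k) ^ (-∑ k, (expo i j k - 1)))) := by
  rw [expo_sum, expo_prod i j _ he, extCoord_castSucc, extCoord_castSucc]
  have hA : 0 < ∑ k, 1 / extCoord x k :=
    Finset.sum_pos (fun k _ => by have := he k; positivity) Finset.univ_nonempty
  have hi : 0 < x i := by simpa [extCoord_castSucc] using he i.castSucc
  have hj : 0 < x j := by simpa [extCoord_castSucc] using he j.castSucc
  have hs : ∑ k, (1 / ((d:ℝ)+1)) ^ 2 / extCoord x k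
      = (1 / ((d:ℝ)+1)) ^ 2 * ∑ k, 1 / extCoord x k := by
    rw [Finset.mul_sum]; apply Finset.sum_congr rfl; intro k _; ring
  have hn : (0:ℝ) < 1 / ((d:ℝ)+1) := by positivity
  have hnp : ((1 / ((d:ℝ)+1)) ^ 2) ^ (((d:ℝ)+1)/2) = (1 / ((d:ℝ)+1)) ^ (d+1) := by
    rw [← Real.rpow_natCast _ 2, ← Real.rpow_mul hn.le, ← Real.rpow_natCast]
    congr 1; push_cast; ring
  unfold rhoD KK
  simp only [zero_add]
  rw [hs, Real.mul_rpow (by positivity) hA.le, hnp, Real.Gamma_one_half_eq, sqrt_pi_pow]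
  rw [Real.rpow_neg hA.le, Real.rpow_add hA, Real.rpow_two]
  simp only [Finset.prod_const, Finset.card_univ, Fintype.card_fin]
  have h2 := Real.Gamma_pos_of_pos (show 0 < ((d:ℝ)+1)/2 + 2 by positivity)
  have hAp : 0 < (∑ k, 1 / extCoord x k) ^ (((d:ℝ)+1)/2) := by positivity
  have hnn : 0 < (1 / ((d:ℝ)+1)) ^ (d+1) := by positivity
  have hpi : 0 < √Real.pi ^ (d+1) := by positivity
  generalize (∑ k, 1 / extCoord x k) ^ (((d:ℝ)+1)/2) = B at *
  generalize (∑ k, 1 / extCoord x k) = A at *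
  generalize Real.Gamma (((d:ℝ)+1)/2 + 2) = G at *
  generalize (1 / ((d:ℝ)+1)) ^ (d+1) = N at *
  generalize √Real.pi ^ (d+1) = P at *
  field_simp

lemma integrand_zero {d : ℕ} (p : Fin (d+1) → ℝ) (x : Fin d → ℝ) (k : Fin (d+1))
    (hk : extCoord x k = 0) : rhoD d 0 p x = 0 := by
  unfold rhoD
  have h : ∏ j, extCoord x j ^ (-(3 : ℝ) / 2) = 0 :=
    Finset.prod_eq_zero (Finset.mem_univ k) (by rw [hk, Real.zero_rpow (by norm_num)])
  rw [h]
  simp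

lemma pointwise {d : ℕ} (i j : Fin d) (x : Fin d → ℝ) :
    (simplexDelta d).indicator (fun x => ENNReal.ofReal
      ((1 / (x i * x j)) / (∑ k, 1 / extCoord x k) ^ 2 *
        rhoD d 0 (fun _ => 1 / ((d : ℝ) + 1)) x)) x
    = ENNReal.ofReal (KK d) * ∫⁻ r in Ioi (0:ℝ), ENNReal.ofReal (r ^ d) *
        ∏ k, igk (expo i j k) (r * extCoord x k) := by
  by_cases he : ∀ k, 0 < extCoord x k
  · rw [indicator_of_mem ((mem_simplex_iff x).2 fun k => (he k).le), inner_lint _ (expo_gt i j) _ he,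
      ← ENNReal.ofReal_mul (KK_nonneg d), integrand_pos i j x he]
  · push Not at he
    obtain ⟨k, hk⟩ := he
    have h0 : ∫⁻ r in Ioi (0:ℝ), ENNReal.ofReal (r ^ d) *
        ∏ k, igk (expo i j k) (r * extCoord x k) = 0 := by
      rw [← lintegral_zero (μ := volume.restrict (Ioi (0:ℝ)))]
      apply setLIntegral_congr_fun measurableSet_Ioi
      intro r hr
      have hr : 0 < r := hr
      simp only
      rw [Finset.prod_eq_zero (Finset.mem_univ k), mul_zero]
      exact igk_of_nonpos (mul_nonpos_of_nonneg_of_nonpos hr.le hk)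
    rw [h0, mul_zero]
    by_cases hx : x ∈ simplexDelta d
    · rw [indicator_of_mem hx, integrand_zero _ x k (le_antisymm hk ((mem_simplex_iff x).1 hx k))]
      simp
    · rw [indicator_of_notMem hx]

lemma measurableSet_simplexDelta (d : ℕ) : MeasurableSet (simplexDelta d) := by
  have : simplexDelta d = ⋂ k, {x | 0 ≤ extCoord x k} := by
    ext x; simp [mem_simplex_iff]
  rw [this]
  exact MeasurableSet.iInter fun k => measurableSet_le measurable_const (measurable_extCoord k)

lemma rho_nonneg {d : ℕ} (x : Fin d → ℝ) (hx : ∀ k, 0 ≤ extCoord x k) :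
    0 ≤ rhoD d 0 (fun _ => 1 / ((d : ℝ) + 1)) x := by
  unfold rhoD
  have h1 := Real.Gamma_pos_of_pos (show 0 < 0 + ((d:ℝ)+1)/2 by positivity)
  have h2 := Real.Gamma_pos_of_pos (show (0:ℝ) < 0 + 1/2 by positivity)
  have h3 : 0 ≤ ∏ j, extCoord x j ^ (-(3 : ℝ) / 2) :=
    Finset.prod_nonneg fun k _ => Real.rpow_nonneg (hx k) _
  have h4 : 0 ≤ ∑ j, (1 / ((d : ℝ) + 1)) ^ 2 / extCoord x j :=
    Finset.sum_nonneg fun k _ => div_nonneg (by positivity) (hx k)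
  positivity

/-- With `θ = 0` and uniform weights `p_i = 1/(d+1)`, for `1 ≤ i < j ≤ d`:
`∫_{Δ_d} (1/(x_i x_j))/(Σ_{k=1}^{d+1} 1/x_k)² ρ_d(x) dx = 1/((d+1)(d+3))`. -/
theorem second_moment_offdiagonal (d : ℕ) (hd : 1 ≤ d) (i j : Fin d) (hij : i < j) :
    ∫ x in simplexDelta d,
        (1 / (x i * x j)) / (∑ k, 1 / extCoord x k) ^ 2 *
          rhoD d 0 (fun _ => 1 / ((d : ℝ) + 1)) x
      = 1 / (((d : ℝ) + 1) * ((d : ℝ) + 3)) := by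
  rw [integral_eq_lintegral_of_nonneg_ae]
  · rw [← lintegral_indicator (measurableSet_simplexDelta d)]
    simp only [pointwise]
    rw [lintegral_const_mul' _ _ ENNReal.ofReal_ne_top, cone_lint _ (expo_gt i j),
      ← ENNReal.ofReal_prod_of_nonneg, expo_gamma i j hij, ← ENNReal.ofReal_mul (KK_nonneg d),
      ENNReal.toReal_ofReal (mul_nonneg (KK_nonneg d) (by positivity))]
    · unfold KK
      have h1 := Real.Gamma_pos_of_pos (show 0 < ((d:ℝ)+1)/2 by positivity)
      have h2 : Real.Gamma (((d:ℝ)+1)/2 + 2)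
          = (((d:ℝ)+1)/2 + 1) * ((((d:ℝ)+1)/2) * Real.Gamma (((d:ℝ)+1)/2)) := by
        rw [show ((d:ℝ)+1)/2 + 2 = (((d:ℝ)+1)/2 + 1) + 1 by ring,
          Real.Gamma_add_one (by positivity), Real.Gamma_add_one (by positivity)]
      have hpi : 0 < √Real.pi ^ (d+1) := by positivity
      rw [h2]
      generalize Real.Gamma (((d:ℝ)+1)/2) = G at *
      generalize √Real.pi ^ (d+1) = P at *
      field_simp
      ring
    · intro k _
      exact (Real.Gamma_pos_of_pos (by linarith [expo_gt i j k])).le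
  · filter_upwards [ae_restrict_mem (measurableSet_simplexDelta d)] with x hx
    have hx' := (mem_simplex_iff x).1 hx
    have := rho_nonneg x hx'
    have hi := hx.1 i
    have hj := hx.1 j
    simp only [Pi.zero_apply]
    positivity
  · apply Measurable.aestronglyMeasurable
    unfold rhoD
    have := fun k => measurable_extCoord (d := d) k
    fun_prop
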